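/- For all m ≥ 2 and all n ≥ 4 + m, the coefficient of x^{n-3-m} in the polynomial Q_{n,132}^{(1,1,m,0)}(x) equals 2·C_{m+1} + 8·C_m + 4·C_m·(n-4-m). -/

import Mathlib

open Finset Polynomial

/-- `σ i` matches the quadrant marked mesh pattern `MMP(a,b,c,d)` in `σ`:
there are at least `a` indices `j > i` with `σ j > σ i`, at least `b` indices
`j < i` with `σ j > σ i`, at least `c` indices `j < i` with `σ j < σ i`, and
at least `d` indices `j > i` with `σ j < σ i`. -/
def MatchesMMP {n : ℕ} (a b c d : ℕ) (σ : Equiv.Perm (Fin n)) (i : Fin n) : Prop :=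
  a ≤ (Finset.univ.filter (fun j => i < j ∧ σ i < σ j)).card ∧
  b ≤ (Finset.univ.filter (fun j => j < i ∧ σ i < σ j)).card ∧
  c ≤ (Finset.univ.filter (fun j => j < i ∧ σ j < σ i)).card ∧
  d ≤ (Finset.univ.filter (fun j => i < j ∧ σ j < σ i)).card

instance {n : ℕ} (a b c d : ℕ) (σ : Equiv.Perm (Fin n)) :
    DecidablePred (MatchesMMP a b c d σ) := fun i => by
  unfold MatchesMMP; infer_instance

/-- `mmp a b c d σ` is the number of indices `i` such that `σ i` matches
`MMP(a,b,c,d)` in `σ`. -/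
def mmp {n : ℕ} (a b c d : ℕ) (σ : Equiv.Perm (Fin n)) : ℕ :=
  (Finset.univ.filter (MatchesMMP a b c d σ)).card

/-- `σ` avoids the classical pattern 132. -/
def Avoids132 {n : ℕ} (σ : Equiv.Perm (Fin n)) : Prop :=
  ¬ ∃ i j k : Fin n, i < j ∧ j < k ∧ σ i < σ k ∧ σ k < σ j

instance {n : ℕ} : DecidablePred (Avoids132 (n := n)) := fun σ => by
  unfold Avoids132; infer_instance

/-- The set `S_n(132)` of 132-avoiding permutations of `{1,…,n}`. -/
def Av132 (n : ℕ) : Finset (Equiv.Perm (Fin n)) :=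
  Finset.univ.filter Avoids132

/-- `Q n a b c d = Σ_{σ ∈ S_n(132)} x^{mmp^{(a,b,c,d)}(σ)}`, a polynomial in `ℤ[x]`. -/
noncomputable def Q (n a b c d : ℕ) : Polynomial ℤ :=
  ∑ σ ∈ Av132 n, Polynomial.X ^ (mmp a b c d σ)


set_option linter.all false

section Glue
variable {k l : ℕ}

def posA (l : ℕ) {k : ℕ} (p : Fin k) : Fin (k + 1 + l) := Fin.castAdd l (Fin.castAdd 1 p)
def posT (k l : ℕ) : Fin (k + 1 + l) := Fin.castAdd l (Fin.natAdd k (0 : Fin 1))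
def posB (k : ℕ) {l : ℕ} (q : Fin l) : Fin (k + 1 + l) := Fin.natAdd (k + 1) q

@[simp] lemma posA_val (p : Fin k) : (posA l p : ℕ) = p := rfl
@[simp] lemma posT_val : (posT k l : ℕ) = k := rfl
@[simp] lemma posB_val (q : Fin l) : (posB k q : ℕ) = k + 1 + q := rfl

lemma pos_cases {P : Fin (k + 1 + l) → Prop} (hA : ∀ p, P (posA l p)) (hT : P (posT k l))
    (hB : ∀ q, P (posB k q)) (i : Fin (k + 1 + l)) : P i := by
  refine Fin.addCases (fun i => ?_) (fun q => hB q) i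
  refine Fin.addCases (fun p => hA p) (fun t => ?_) i
  rw [Subsingleton.elim t 0]
  exact hT

lemma pos_sum (f : Fin (k + 1 + l) → ℕ) :
    ∑ i, f i = ∑ p, f (posA l p) + f (posT k l) + ∑ q, f (posB k q) := by
  rw [Fin.sum_univ_add, Fin.sum_univ_add]
  simp [posA, posT, posB]

def glueFun (A : Fin k → Fin k) (B : Fin l → Fin l) : Fin (k + 1 + l) → Fin (k + 1 + l) :=
  Fin.addCases (Fin.addCases (fun p => ⟨l + A p, by omega⟩) (fun _ => ⟨k + l, by omega⟩))
    (fun q => ⟨B q, by omega⟩)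

@[simp] lemma glueFun_A (A : Fin k → Fin k) (B : Fin l → Fin l) (p : Fin k) :
    (glueFun A B (posA l p) : ℕ) = l + A p := by simp [glueFun, posA]
@[simp] lemma glueFun_T (A : Fin k → Fin k) (B : Fin l → Fin l) :
    (glueFun A B (posT k l) : ℕ) = k + l := by
  simp only [glueFun, posT, Fin.addCases_left, Fin.addCases_right]
@[simp] lemma glueFun_B (A : Fin k → Fin k) (B : Fin l → Fin l) (q : Fin l) :
    (glueFun A B (posB k q) : ℕ) = B q := by simp [glueFun, posB]

lemma glueFun_inj (A : Equiv.Perm (Fin k)) (B : Equiv.Perm (Fin l)) :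
    Function.Injective (glueFun A B) := by
  intro i j
  rw [Fin.ext_iff]
  induction i using pos_cases with
  | hA p =>
    induction j using pos_cases with
    | hA p' =>
      simp only [glueFun_A]
      intro h
      rw [A.injective (Fin.ext (by omega) : A p = A p')]
    | hT => simp only [glueFun_A, glueFun_T]; omega
    | hB q => simp only [glueFun_A, glueFun_B]; omega
  | hT =>
    induction j using pos_cases with
    | hA p' => simp only [glueFun_A, glueFun_T]; omega
    | hT => simp
    | hB q => simp only [glueFun_T, glueFun_B]; omega
  | hB q =>
    induction j using pos_cases with
    | hA p' => simp only [glueFun_A, glueFun_B]; omega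
    | hT => simp only [glueFun_T, glueFun_B]; omega
    | hB q' =>
      simp only [glueFun_B]
      intro h
      rw [B.injective (Fin.ext (by omega) : B q = B q')]

noncomputable def glue (A : Equiv.Perm (Fin k)) (B : Equiv.Perm (Fin l)) :
    Equiv.Perm (Fin (k + 1 + l)) :=
  Equiv.ofBijective (glueFun A B) (Finite.injective_iff_bijective.mp (glueFun_inj A B))

variable (A : Equiv.Perm (Fin k)) (B : Equiv.Perm (Fin l))

@[simp] lemma glue_A (p : Fin k) : (glue A B (posA l p) : ℕ) = l + A p := glueFun_A _ _ _
@[simp] lemma glue_T : (glue A B (posT k l) : ℕ) = k + l := glueFun_T _ _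
@[simp] lemma glue_B (q : Fin l) : (glue A B (posB k q) : ℕ) = B q := glueFun_B _ _ _

lemma glue_inj {A A' : Equiv.Perm (Fin k)} {B B' : Equiv.Perm (Fin l)}
    (h : glue A B = glue A' B') : A = A' ∧ B = B' := by
  constructor
  · ext p
    have := congrArg Fin.val (DFunLike.congr_fun h (posA l p))
    simp at this
    exact this
  · ext q
    have := congrArg Fin.val (DFunLike.congr_fun h (posB k q))
    simp at this
    exact this

lemma glue_avoids : Avoids132 (glue A B) ↔ Avoids132 A ∧ Avoids132 B := by
  constructor
  · intro h
    constructor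
    · rintro ⟨x, y, z, h1, h2, h3, h4⟩
      refine h ⟨posA l x, posA l y, posA l z, ?_⟩
      simp only [Fin.lt_def, glue_A, posA_val] at *
      omega
    · rintro ⟨x, y, z, h1, h2, h3, h4⟩
      refine h ⟨posB k x, posB k y, posB k z, ?_⟩
      simp only [Fin.lt_def, glue_B, posB_val] at *
      omega
  · rintro ⟨hA, hB⟩ ⟨x, y, z, h1, h2, h3, h4⟩
    have key : (∃ x' y' z', x = posA l x' ∧ y = posA l y' ∧ z = posA l z') ∨
        (∃ x' y' z', x = posB k x' ∧ y = posB k y' ∧ z = posB k z') := by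
      simp only [Fin.lt_def] at h1 h2 h3 h4
      induction x using pos_cases with
      | hA p =>
        induction z using pos_cases with
        | hA p' =>
          induction y using pos_cases with
          | hA p'' => exact Or.inl ⟨_, _, _, rfl, rfl, rfl⟩
          | hT => simp at h2; omega
          | hB q => simp at h2; omega
        | hT => simp only [glue_T] at h4; omega
        | hB q => simp at h3; omega
      | hT => simp only [glue_T] at h3; omega
      | hB q =>
        induction y using pos_cases with
        | hA p'' => simp at h1; omega
        | hT => simp at h1; omega
        | hB q =>
          induction z using pos_cases with
          | hA p'' => simp at h2; omega
          | hT => simp at h2; omega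
          | hB q => exact Or.inr ⟨_, _, _, rfl, rfl, rfl⟩
    rcases key with ⟨x', y', z', rfl, rfl, rfl⟩ | ⟨x', y', z', rfl, rfl, rfl⟩
    · refine hA ⟨x', y', z', ?_⟩
      simp only [Fin.lt_def, glue_A, posA_val] at *
      omega
    · refine hB ⟨x', y', z', ?_⟩
      simp only [Fin.lt_def, glue_B, posB_val] at *
      omega

lemma glue_surj (σ : Equiv.Perm (Fin (k + 1 + l))) (hσ : Avoids132 σ)
    (hT : (σ (posT k l) : ℕ) = k + l) :
    ∃ (A : Equiv.Perm (Fin k)) (B : Equiv.Perm (Fin l)), glue A B = σ := by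
  have hlt : ∀ p q, (σ (posB k q) : ℕ) < σ (posA l p) := by
    intro p q
    by_contra hc
    refine hσ ⟨posA l p, posT k l, posB k q, ?_, ?_, ?_, ?_⟩
    · simp [Fin.lt_def]
    · simp [Fin.lt_def]; try omega
    · have : σ (posA l p) ≠ σ (posB k q) := by
        intro h
        have := congrArg Fin.val (σ.injective h)
        simp at this; omega
      rw [Fin.lt_def]
      have := Fin.val_ne_of_ne this
      omega
    · rw [Fin.lt_def, hT]
      have : σ (posB k q) ≠ σ (posT k l) := by
        intro h
        have := congrArg Fin.val (σ.injective h)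
        simp at this; omega
      have := Fin.val_ne_of_ne this
      omega
  have hAl : ∀ p, l ≤ (σ (posA l p) : ℕ) := by
    intro p
    have : (Finset.univ.image (fun q : Fin l => (σ (posB k q) : ℕ))) ⊆
        Finset.range (σ (posA l p) : ℕ) := by
      intro x hx
      simp only [Finset.mem_image, Finset.mem_univ, true_and] at hx
      obtain ⟨q, rfl⟩ := hx
      simpa using hlt p q
    have := Finset.card_le_card this
    rw [Finset.card_image_of_injective] at this
    · simpa using this
    · intro q q' h
      have := congrArg Fin.val (σ.injective (Fin.ext h))
      simp at this
      exact Fin.ext this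
  have hAu : ∀ p, (σ (posA l p) : ℕ) < k + l := by
    intro p
    have : σ (posA l p) ≠ σ (posT k l) := by
      intro h
      have := congrArg Fin.val (σ.injective h)
      simp at this; omega
    have := Fin.val_ne_of_ne this
    omega
  have hBu : ∀ q, (σ (posB k q) : ℕ) < l := by
    intro q
    have : (Finset.univ.image (fun p : Fin k => (σ (posA l p) : ℕ))) ⊆
        Finset.Ico (σ (posB k q) + 1 : ℕ) (k + l) := by
      intro x hx
      simp only [Finset.mem_image, Finset.mem_univ, true_and] at hx
      obtain ⟨p, rfl⟩ := hx
      have := hlt p q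
      have := hAu p
      simp; omega
    have := Finset.card_le_card this
    rw [Finset.card_image_of_injective] at this
    · simp at this
      have h2 : σ (posB k q) ≠ σ (posT k l) := by
        intro h
        have := congrArg Fin.val (σ.injective h)
        simp at this; omega
      have := Fin.val_ne_of_ne h2
      omega
    · intro q q' h
      have := congrArg Fin.val (σ.injective (Fin.ext h))
      simp at this
      exact Fin.ext this
  have iA : Function.Injective (fun p : Fin k =>
      (⟨σ (posA l p) - l, by have := hAl p; have := hAu p; omega⟩ : Fin k)) := by
    intro p p' h
    simp only [Fin.mk.injEq] at h
    have h1 := hAl p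
    have h2 := hAl p'
    have := congrArg Fin.val (σ.injective (Fin.ext (by omega) : σ (posA l p) = σ (posA l p')))
    simp at this
    exact Fin.ext this
  have iB : Function.Injective (fun q : Fin l => (⟨σ (posB k q), hBu q⟩ : Fin l)) := by
    intro p p' h
    simp only [Fin.mk.injEq] at h
    have := congrArg Fin.val (σ.injective (Fin.ext h))
    simp at this
    exact Fin.ext this
  refine ⟨Equiv.ofBijective _ (Finite.injective_iff_bijective.mp iA),
    Equiv.ofBijective _ (Finite.injective_iff_bijective.mp iB), ?_⟩
  ext i
  induction i using pos_cases with
  | hA p =>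
    have := hAl p
    simp; omega
  | hT => simp [hT]
  | hB q => simp

lemma pos_lt_AA (x : Fin k) (y : Fin k) : posA l x < posA l y ↔ x < y := by
  simp only [Fin.lt_def, posA_val, posB_val, posT_val, iff_true, iff_false]
  try omega
lemma val_lt_AA (x : Fin k) (y : Fin k) :
    glue A B (posA l x) < glue A B (posA l y) ↔ A x < A y := by
  simp only [Fin.lt_def, glue_A, glue_B, glue_T, iff_true, iff_false]
  try omega
lemma pos_lt_AT (x : Fin k) : posA l x < posT k l ↔ True := by
  simp only [Fin.lt_def, posA_val, posB_val, posT_val, iff_true, iff_false]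
  try omega
lemma val_lt_AT (x : Fin k) :
    glue A B (posA l x) < glue A B (posT k l) ↔ True := by
  simp only [Fin.lt_def, glue_A, glue_B, glue_T, iff_true, iff_false]
  try omega
lemma pos_lt_AB (x : Fin k) (y : Fin l) : posA l x < posB k y ↔ True := by
  simp only [Fin.lt_def, posA_val, posB_val, posT_val, iff_true, iff_false]
  try omega
lemma val_lt_AB (x : Fin k) (y : Fin l) :
    glue A B (posA l x) < glue A B (posB k y) ↔ False := by
  simp only [Fin.lt_def, glue_A, glue_B, glue_T, iff_true, iff_false]
  try omega
lemma pos_lt_TA (y : Fin k) : posT k l < posA l y ↔ False := by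
  simp only [Fin.lt_def, posA_val, posB_val, posT_val, iff_true, iff_false]
  try omega
lemma val_lt_TA (y : Fin k) :
    glue A B (posT k l) < glue A B (posA l y) ↔ False := by
  simp only [Fin.lt_def, glue_A, glue_B, glue_T, iff_true, iff_false]
  try omega
lemma pos_lt_TT : posT k l < posT k l ↔ False := by
  simp only [Fin.lt_def, posA_val, posB_val, posT_val, iff_true, iff_false]
  try omega
lemma val_lt_TT :
    glue A B (posT k l) < glue A B (posT k l) ↔ False := by
  simp only [Fin.lt_def, glue_A, glue_B, glue_T, iff_true, iff_false]
  try omega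
lemma pos_lt_TB (y : Fin l) : posT k l < posB k y ↔ True := by
  simp only [Fin.lt_def, posA_val, posB_val, posT_val, iff_true, iff_false]
  try omega
lemma val_lt_TB (y : Fin l) :
    glue A B (posT k l) < glue A B (posB k y) ↔ False := by
  simp only [Fin.lt_def, glue_A, glue_B, glue_T, iff_true, iff_false]
  try omega
lemma pos_lt_BA (x : Fin l) (y : Fin k) : posB k x < posA l y ↔ False := by
  simp only [Fin.lt_def, posA_val, posB_val, posT_val, iff_true, iff_false]
  try omega
lemma val_lt_BA (x : Fin l) (y : Fin k) :
    glue A B (posB k x) < glue A B (posA l y) ↔ True := by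
  simp only [Fin.lt_def, glue_A, glue_B, glue_T, iff_true, iff_false]
  try omega
lemma pos_lt_BT (x : Fin l) : posB k x < posT k l ↔ False := by
  simp only [Fin.lt_def, posA_val, posB_val, posT_val, iff_true, iff_false]
  try omega
lemma val_lt_BT (x : Fin l) :
    glue A B (posB k x) < glue A B (posT k l) ↔ True := by
  simp only [Fin.lt_def, glue_A, glue_B, glue_T, iff_true, iff_false]
  try omega
lemma pos_lt_BB (x : Fin l) (y : Fin l) : posB k x < posB k y ↔ x < y := by
  simp only [Fin.lt_def, posA_val, posB_val, posT_val, iff_true, iff_false]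
  try omega
lemma val_lt_BB (x : Fin l) (y : Fin l) :
    glue A B (posB k x) < glue A B (posB k y) ↔ B x < B y := by
  simp only [Fin.lt_def, glue_A, glue_B, glue_T, iff_true, iff_false]
  try omega

lemma mmp_glue (a b m : ℕ) (hb : b ≤ 1) : mmp a b m 0 (glue A B) =
    mmp (a - 1) b m 0 A + (if a = 0 ∧ b = 0 ∧ m ≤ k then 1 else 0) + mmp a 0 m 0 B := by
  unfold mmp
  simp only [Finset.card_filter]
  rw [pos_sum]
  congr 1
  · congr 1
    · refine Finset.sum_congr rfl fun p _ => if_congr ?_ rfl rfl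
      unfold MatchesMMP
      simp only [Finset.card_filter, pos_sum]
      simp only [pos_lt_AA, val_lt_AA, pos_lt_AT, val_lt_AT, pos_lt_AB, val_lt_AB, pos_lt_TA, val_lt_TA, pos_lt_TT, val_lt_TT, pos_lt_TB, val_lt_TB, pos_lt_BA, val_lt_BA, pos_lt_BT, val_lt_BT, pos_lt_BB, val_lt_BB]
      simp
    · refine if_congr ?_ rfl rfl
      unfold MatchesMMP
      simp only [Finset.card_filter, pos_sum]
      simp only [pos_lt_AA, val_lt_AA, pos_lt_AT, val_lt_AT, pos_lt_AB, val_lt_AB, pos_lt_TA, val_lt_TA, pos_lt_TT, val_lt_TT, pos_lt_TB, val_lt_TB, pos_lt_BA, val_lt_BA, pos_lt_BT, val_lt_BT, pos_lt_BB, val_lt_BB]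
      simp
  · refine Finset.sum_congr rfl fun q _ => if_congr ?_ rfl rfl
    unfold MatchesMMP
    simp only [Finset.card_filter, pos_sum]
    simp only [pos_lt_AA, val_lt_AA, pos_lt_AT, val_lt_AT, pos_lt_AB, val_lt_AB, pos_lt_TA, val_lt_TA, pos_lt_TT, val_lt_TT, pos_lt_TB, val_lt_TB, pos_lt_BA, val_lt_BA, pos_lt_BT, val_lt_BT, pos_lt_BB, val_lt_BB]
    simp
    intros
    omega

end Glue

section Alg
open Finset

lemma coeff_mul_zero {f g : ℤ[X]} {p q d : ℕ} (hf : X ^ p ∣ f) (hg : X ^ q ∣ g) (h : d < p + q) :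
    (f * g).coeff d = 0 := by
  have : (X : ℤ[X]) ^ (p + q) ∣ f * g := by rw [pow_add]; exact mul_dvd_mul hf hg
  exact X_pow_dvd_iff.mp this d h

variable {m : ℕ} {F G : ℕ → ℤ[X]}

lemma F_small (F0 : F 0 = 1)
    (hF : ∀ n, F (n + 1) = ∑ p ∈ antidiagonal n, X ^ (if p.1 < m then 1 else 0) * (F p.1 * F p.2))
    (n : ℕ) (hn : n ≤ m) : F n = C (catalan n : ℤ) * X ^ n := by
  induction n using Nat.strong_induction_on with
  | _ n ih =>
    cases n with
    | zero => simp [F0]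
    | succ n =>
      rw [hF, catalan_succ']
      push_cast
      rw [map_sum, Finset.sum_mul]
      refine sum_congr rfl fun p hp => ?_
      have := mem_antidiagonal.mp hp
      rw [if_pos (by omega), ih p.1 (by omega) (by omega), ih p.2 (by omega) (by omega), ← this]
      simp only [map_mul]
      ring

lemma F_dvd (F0 : F 0 = 1)
    (hF : ∀ n, F (n + 1) = ∑ p ∈ antidiagonal n, X ^ (if p.1 < m then 1 else 0) * (F p.1 * F p.2))
    (n : ℕ) : X ^ (min n m) ∣ F n := by
  induction n using Nat.strong_induction_on with
  | _ n ih =>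
    cases n with
    | zero => simp
    | succ n =>
      rw [hF]
      refine dvd_sum fun p hp => ?_
      have := mem_antidiagonal.mp hp
      have h := mul_dvd_mul (dvd_refl (X ^ (if p.1 < m then 1 else 0) : ℤ[X]))
        (mul_dvd_mul (ih p.1 (by omega)) (ih p.2 (by omega)))
      refine dvd_trans ?_ h
      rw [← pow_add, ← pow_add]
      apply pow_dvd_pow
      split_ifs <;> omega

lemma F_m (hm : 2 ≤ m) (F0 : F 0 = 1)
    (hF : ∀ n, F (n + 1) = ∑ p ∈ antidiagonal n, X ^ (if p.1 < m then 1 else 0) * (F p.1 * F p.2))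
    (n : ℕ) (hn : m ≤ n) : (F n).coeff m = catalan m := by
  induction n, hn using Nat.le_induction with
  | base => rw [F_small F0 hF m le_rfl]; simp
  | succ n hn ih =>
    obtain ⟨n, rfl⟩ : ∃ n', n = n' + 1 := ⟨n - 1, by omega⟩
    rw [hF, Finset.Nat.sum_antidiagonal_succ', coeff_add, finsetSum_coeff]
    rw [sum_eq_zero]
    · rw [if_neg (by simp; omega)]
      simp [F0, ih]
    · intro p hp
      have := mem_antidiagonal.mp hp
      refine coeff_mul_zero (dvd_refl _) (mul_dvd_mul (F_dvd F0 hF _) (F_dvd F0 hF _)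
        |> fun h => by rw [← pow_add] at h; exact h) ?_
      simp only
      split_ifs <;> omega

lemma F_m1_base (F0 : F 0 = 1)
    (hF : ∀ n, F (n + 1) = ∑ p ∈ antidiagonal n, X ^ (if p.1 < m then 1 else 0) * (F p.1 * F p.2)) :
    (F (m + 1)).coeff (m + 1) = catalan (m + 1) - catalan m := by
  have h : (catalan (m + 1) : ℤ) = ∑ p ∈ antidiagonal m, ((catalan p.1 * catalan p.2 : ℕ) : ℤ) := by
    rw [catalan_succ']; push_cast; rfl
  have h2 : (catalan m : ℤ) = ∑ p ∈ antidiagonal m, if p = (m, 0) then (catalan m : ℤ) else 0 := by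
    rw [Finset.sum_ite_eq' ]; simp
  rw [h, h2, hF, finsetSum_coeff, ← sum_sub_distrib]
  refine sum_congr rfl fun p hp => ?_
  have := mem_antidiagonal.mp hp
  rw [F_small F0 hF p.1 (by omega), F_small F0 hF p.2 (by omega)]
  have e : (X : ℤ[X]) ^ (if p.1 < m then 1 else 0) * (C (catalan p.1 : ℤ) * X ^ p.1 * (C (catalan p.2 : ℤ) * X ^ p.2))
    = C (catalan p.1 * catalan p.2 : ℤ) * X ^ (m + (if p.1 < m then 1 else 0)) := by
    rw [← this]
    simp only [map_mul]
    ring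
  rw [e, coeff_C_mul, coeff_X_pow]
  by_cases h : p.1 < m
  · have : p ≠ (m, 0) := by rintro rfl; simp at h
    simp [h, this]
  · have : p = (m, 0) := Prod.ext (by simp; omega) (by simp; omega)
    subst this
    simp

lemma F_m1 (hm : 2 ≤ m) (F0 : F 0 = 1)
    (hF : ∀ n, F (n + 1) = ∑ p ∈ antidiagonal n, X ^ (if p.1 < m then 1 else 0) * (F p.1 * F p.2))
    (r : ℕ) : (F (m + 1 + r)).coeff (m + 1) = catalan (m + 1) - catalan m + 2 * catalan m * r := by
  induction r with
  | zero => simpa using F_m1_base F0 hF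
  | succ r ih =>
    obtain ⟨s, hs⟩ : ∃ s, m + 1 + r = s + 3 := ⟨m + r - 2, by omega⟩
    rw [← add_assoc, hF, hs, Finset.Nat.sum_antidiagonal_succ', Finset.Nat.sum_antidiagonal_succ',
      Finset.Nat.sum_antidiagonal_succ, coeff_add, coeff_add, coeff_add, finsetSum_coeff]
    have F1 : F 1 = X := by rw [F_small F0 hF 1 (by omega)]; simp
    have hm1 := F_m hm F0 hF (s + 2) (by omega)
    have hm0 := F_m hm F0 hF (s + 3) (by omega)
    rw [sum_eq_zero]
    · have h1 : ¬ (s + 3 < m) := by omega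
      have h2 : ¬ (s + 1 + 1 < m) := by omega
      rw [hs] at ih
      have h3 : 0 < m := by omega
      simp [h1, h2, h3, F0, F1, ih, coeff_X_mul, coeff_mul_X, hm1, hm0]
      ring
    · intro p hp
      have := mem_antidiagonal.mp hp
      refine coeff_mul_zero (dvd_refl _) (mul_dvd_mul (F_dvd F0 hF _) (F_dvd F0 hF _)
        |> fun h => by rw [← pow_add] at h; exact h) ?_
      simp only
      split_ifs <;> omega

lemma G_dvd (F0 : F 0 = 1)
    (hF : ∀ n, F (n + 1) = ∑ p ∈ antidiagonal n, X ^ (if p.1 < m then 1 else 0) * (F p.1 * F p.2))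
    (hG : ∀ n, G (n + 1) = ∑ p ∈ antidiagonal n, X * (F p.1 * G p.2))
    (n : ℕ) : X ^ (min n (m + 1)) ∣ G n := by
  induction n using Nat.strong_induction_on with
  | _ n ih =>
    cases n with
    | zero => simp
    | succ n =>
      rw [hG]
      refine dvd_sum fun p hp => ?_
      have := mem_antidiagonal.mp hp
      have h := mul_dvd_mul (dvd_refl (X ^ 1 : ℤ[X]))
        (mul_dvd_mul (F_dvd F0 hF p.1) (ih p.2 (by omega)))
      rw [pow_one] at h
      refine dvd_trans ?_ h
      nth_rw 2 [← pow_one X]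
      rw [← pow_add, ← pow_add]
      apply pow_dvd_pow
      omega

lemma G_1 (hm : 2 ≤ m) (F0 : F 0 = 1) (G0 : G 0 = 1)
    (hF : ∀ n, F (n + 1) = ∑ p ∈ antidiagonal n, X ^ (if p.1 < m then 1 else 0) * (F p.1 * F p.2))
    (hG : ∀ n, G (n + 1) = ∑ p ∈ antidiagonal n, X * (F p.1 * G p.2))
    (n : ℕ) (hn : m + 2 ≤ n) : (G n).coeff (m + 1) = catalan m := by
  obtain ⟨n, rfl⟩ : ∃ n', n = n' + 2 := ⟨n - 2, by omega⟩
  rw [hG, Finset.Nat.sum_antidiagonal_succ', coeff_add, finsetSum_coeff, sum_eq_zero]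
  · simp [G0, coeff_X_mul, F_m hm F0 hF (n + 1) (by omega)]
  · intro p hp
    have := mem_antidiagonal.mp hp
    rw [coeff_X_mul]
    refine coeff_mul_zero (F_dvd F0 hF _) (G_dvd F0 hF hG _) ?_
    simp only
    omega

lemma G_2 (hm : 2 ≤ m) (F0 : F 0 = 1) (G0 : G 0 = 1)
    (hF : ∀ n, F (n + 1) = ∑ p ∈ antidiagonal n, X ^ (if p.1 < m then 1 else 0) * (F p.1 * F p.2))
    (hG : ∀ n, G (n + 1) = ∑ p ∈ antidiagonal n, X * (F p.1 * G p.2))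
    (r : ℕ) : (G (m + 3 + r)).coeff (m + 2) =
      catalan (m + 1) - catalan m + 2 * catalan m * (r + 1) + 2 * catalan m := by
  have G1 : G 1 = X := by rw [hG]; simp [F0, G0]
  have e : m + 3 + r = (m + r - 1) + 1 + 1 + 1 + 1 := by omega
  obtain ⟨s, hs⟩ : ∃ s, m + r - 1 = s := ⟨_, rfl⟩
  rw [hs] at e
  rw [e, hG, Finset.Nat.sum_antidiagonal_succ', Finset.Nat.sum_antidiagonal_succ',
      Finset.Nat.sum_antidiagonal_succ, coeff_add, coeff_add, coeff_add, finsetSum_coeff,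
      sum_eq_zero]
  · have h1 := F_m1 hm F0 hF (r + 1)
    rw [show m + 1 + (r + 1) = s + 3 by omega] at h1
    have h2 := F_m hm F0 hF (s + 2) (by omega)
    have h3 := G_1 hm F0 G0 hF hG (s + 1 + 1 + 1) (by omega)
    simp [G0, G1, F0, coeff_X_mul, coeff_mul_X, h1, h2, h3]
    ring
  · intro p hp
    have := mem_antidiagonal.mp hp
    rw [coeff_X_mul]
    refine coeff_mul_zero (F_dvd F0 hF _) (G_dvd F0 hF hG _) ?_
    simp only
    omega

lemma H_coeff (hm : 2 ≤ m) (F0 : F 0 = 1) (G0 : G 0 = 1)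
    (hF : ∀ n, F (n + 1) = ∑ p ∈ antidiagonal n, X ^ (if p.1 < m then 1 else 0) * (F p.1 * F p.2))
    (hG : ∀ n, G (n + 1) = ∑ p ∈ antidiagonal n, X * (F p.1 * G p.2))
    (r : ℕ) : (∑ p ∈ antidiagonal (m + 3 + r), X * (G p.1 * G p.2)).coeff (m + 3) =
      (2 * catalan (m + 1) + 8 * catalan m + 4 * catalan m * r : ℤ) := by
  have G1 : G 1 = X := by rw [hG]; simp [F0, G0]
  have e : m + 3 + r = (m + r - 1) + 1 + 1 + 1 + 1 := by omega
  obtain ⟨s, hs⟩ : ∃ s, m + r - 1 = s := ⟨_, rfl⟩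
  rw [hs] at e
  rw [e, Finset.Nat.sum_antidiagonal_succ', Finset.Nat.sum_antidiagonal_succ',
      Finset.Nat.sum_antidiagonal_succ, Finset.Nat.sum_antidiagonal_succ,
      coeff_add, coeff_add, coeff_add, coeff_add, finsetSum_coeff, sum_eq_zero]
  · have h1 := G_2 hm F0 G0 hF hG r
    rw [e] at h1
    have h3 := G_1 hm F0 G0 hF hG (s + 1 + 1 + 1) (by omega)
    simp [G0, G1, coeff_X_mul, coeff_mul_X, h1, h3]
    ring
  · intro p hp
    have := mem_antidiagonal.mp hp
    rw [coeff_X_mul]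
    refine coeff_mul_zero (G_dvd F0 hF hG _) (G_dvd F0 hF hG _) ?_
    simp only
    omega

end Alg

lemma mmp_le {n : ℕ} (a b c d : ℕ) (σ : Equiv.Perm (Fin n)) : mmp a b c d σ ≤ n := by
  unfold mmp
  exact (Finset.card_le_univ _).trans (by simp)

/-- generating polynomial by the number of non-matching entries -/
noncomputable def defPoly (a b m n : ℕ) : ℤ[X] :=
  ∑ σ ∈ Av132 n, X ^ (n - mmp a b m 0 σ)

lemma fiber_sum (a b m : ℕ) (hb : b ≤ 1) (k l N : ℕ) (h : N = k + 1 + l) :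
    ∑ σ ∈ (Av132 N).filter (fun σ => ∀ i : Fin N, (i : ℕ) = k → (σ i : ℕ) = k + l),
      (X : ℤ[X]) ^ (N - mmp a b m 0 σ) =
    X ^ (if a = 0 ∧ b = 0 ∧ m ≤ k then 0 else 1) * (defPoly (a - 1) b m k * defPoly a 0 m l) := by
  subst h
  unfold defPoly
  rw [Finset.sum_mul_sum, ← Finset.sum_product', Finset.mul_sum]
  symm
  refine Finset.sum_bij (fun AB _ => glue AB.1 AB.2) ?_ ?_ ?_ ?_
  · rintro ⟨A, B⟩ hAB
    simp only [Finset.mem_product, Av132, Finset.mem_filter, Finset.mem_univ, true_and] at hAB ⊢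
    refine ⟨(glue_avoids A B).mpr hAB, fun i hi => ?_⟩
    rw [show i = posT k l from Fin.ext hi, glue_T]
  · rintro ⟨A, B⟩ _ ⟨A', B'⟩ _ h
    obtain ⟨rfl, rfl⟩ := glue_inj h
    rfl
  · intro σ hσ
    simp only [Av132, Finset.mem_filter, Finset.mem_univ, true_and] at hσ
    obtain ⟨A, B, rfl⟩ := glue_surj σ hσ.1 (hσ.2 _ rfl)
    have := (glue_avoids A B).mp hσ.1
    exact ⟨(A, B), by simpa [Av132] using this, rfl⟩
  · rintro ⟨A, B⟩ _
    simp only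
    rw [mmp_glue _ _ _ _ _ hb, ← pow_add, ← pow_add]
    congr 1
    have h1 := mmp_le (a - 1) b m 0 A
    have h2 := mmp_le a 0 m 0 B
    split_ifs <;> omega

lemma defPoly_rec (a b m : ℕ) (hb : b ≤ 1) (n : ℕ) :
    defPoly a b m (n + 1) = ∑ p ∈ Finset.HasAntidiagonal.antidiagonal n,
      X ^ (if a = 0 ∧ b = 0 ∧ m ≤ p.1 then 0 else 1) *
        (defPoly (a - 1) b m p.1 * defPoly a 0 m p.2) := by
  unfold defPoly
  rw [← Finset.sum_fiberwise_of_maps_to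
    (g := fun σ : Equiv.Perm (Fin (n + 1)) =>
      ((σ.symm (Fin.last n) : ℕ), n - (σ.symm (Fin.last n) : ℕ)))
    (t := Finset.HasAntidiagonal.antidiagonal n)]
  · refine Finset.sum_congr rfl fun p hp => ?_
    have hp' := Finset.HasAntidiagonal.mem_antidiagonal.mp hp
    have := fiber_sum a b m hb p.1 p.2 (n + 1) (by omega)
    unfold defPoly at this
    rw [← this]
    refine Finset.sum_congr (Finset.filter_congr fun σ _ => ?_) fun _ _ => rfl
    constructor
    · rintro rfl i hi
      rw [show i = σ.symm (Fin.last n) from Fin.ext hi]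
      simp only [Equiv.apply_symm_apply, Fin.val_last]
      exact hp'.symm
    · intro h
      have h1 := h ⟨p.1, by omega⟩ rfl
      have h2 : σ ⟨p.1, by omega⟩ = Fin.last n := Fin.ext (by rw [h1, hp']; simp)
      rw [← h2, Equiv.symm_apply_apply]
      exact Prod.ext rfl (by simp; omega)
  · intro σ _
    simp only [Finset.HasAntidiagonal.mem_antidiagonal]
    omega

lemma defPoly_zero (a b m : ℕ) : defPoly a b m 0 = 1 := by
  unfold defPoly
  have : Av132 0 = {1} := by decide
  rw [this]
  simp

lemma defPoly_swap (m n : ℕ) : defPoly 0 1 m n = defPoly 1 0 m n := by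
  induction n using Nat.strong_induction_on with
  | _ n ih =>
    cases n with
    | zero => simp [defPoly_zero]
    | succ n =>
      rw [defPoly_rec _ _ _ le_rfl, defPoly_rec _ _ _ (by omega),
        ← Finset.Nat.sum_antidiagonal_swap]
      refine Finset.sum_congr rfl fun p hp => ?_
      have hp' := Finset.HasAntidiagonal.mem_antidiagonal.mp hp
      simp only [Prod.fst_swap, Prod.snd_swap]
      rw [ih p.2 (by omega)]
      simp [mul_comm]

lemma Q_coeff (a b m n d : ℕ) (hd : d ≤ n) :
    (Q n a b m 0).coeff (n - d) = (defPoly a b m n).coeff d := by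
  unfold Q defPoly
  rw [finsetSum_coeff, finsetSum_coeff]
  refine Finset.sum_congr rfl fun σ _ => ?_
  have := mmp_le a b m 0 σ
  rw [coeff_X_pow, coeff_X_pow]
  refine if_congr ?_ rfl rfl
  omega

/-- for `m ≥ 2` and `n ≥ 4 + m`, the coefficient of `x^{n-3-m}` in
`Q_{n,132}^{(1,1,m,0)}(x)` equals `2·C_{m+1} + 8·C_m + 4·C_m·(n-4-m)`. -/
theorem stmt4 (m n : ℕ) (hm : 2 ≤ m) (hn : 4 + m ≤ n) :
    (Q n 1 1 m 0).coeff (n - 3 - m) =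
      ((2 * catalan (m + 1) + 8 * catalan m
        + 4 * catalan m * (n - 4 - m) : ℕ) : ℤ) := by
  obtain ⟨r, rfl⟩ : ∃ r, n = m + 3 + r + 1 := ⟨n - 4 - m, by omega⟩
  rw [show m + 3 + r + 1 - 3 - m = m + 3 + r + 1 - (m + 3) by omega,
    show m + 3 + r + 1 - 4 - m = r by omega, Q_coeff _ _ _ _ _ (by omega),
    defPoly_rec _ _ _ le_rfl]
  have H := H_coeff (F := defPoly 0 0 m) (G := defPoly 1 0 m) hm (defPoly_zero _ _ _)
    (defPoly_zero _ _ _) (fun n => by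
      rw [defPoly_rec _ _ _ (by omega)]
      refine Finset.sum_congr rfl fun p _ => ?_
      congr 2
      split_ifs <;> omega)
    (fun n => by
      rw [defPoly_rec _ _ _ (by omega)]
      refine Finset.sum_congr rfl fun p _ => ?_
      simp) r
  push_cast
  rw [← H]
  congr 1
  refine Finset.sum_congr rfl fun p _ => ?_
  simp [defPoly_swap]
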